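/- Let q be a prime, η ∈ (0,1) with m = (1-η)·k an integer, and b > 1. Suppose a mixing matrix M ∈ 𝔽_q^{k×k} decomposes as M = [M₀ | M₁], where M₀ ∈ 𝔽_q^{k×m} consists of the first m columns of M, and suppose ker M₀ᵀ = {x ∈ 𝔽_q^k : xM₀ = 0} is a linear code of distance greater than 2b, i.e. every nonzero x with xM₀ = 0 has Hamming weight greater than 2b. Then for every ε > 0, M satisfies (η, b-ε)-exponential polarization. -/

import Mathlib

open scoped BigOperators

/- Probability of an event under a probability mass function on a finite type. -/
open Classical in
noncomputable def pmfProb {Ω : Type} [Fintype Ω] (μ : Ω → ℝ) (S : Set Ω) : ℝ :=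
  ∑ ω : Ω, if ω ∈ S then μ ω else 0

/- Conditional Shannon entropy (base 2) `H(X|Y)` of finitely-valued random variables
on a finite probability space given by the mass function `μ`. -/
open Classical in
noncomputable def condEnt {Ω S T : Type} [Fintype Ω] [Fintype S] [Fintype T]
    (μ : Ω → ℝ) (X : Ω → S) (Y : Ω → T) : ℝ :=
  ∑ s : S, ∑ t : T,
    (if pmfProb μ {ω | X ω = s ∧ Y ω = t} = 0 then 0
     else -(pmfProb μ {ω | X ω = s ∧ Y ω = t}) *
        Real.logb 2 (pmfProb μ {ω | X ω = s ∧ Y ω = t} / pmfProb μ {ω | Y ω = t}))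

/- Normalized conditional entropy `H̄(X|Y) = H(X|Y)/log₂ q` for `X` valued in `𝔽_q`. -/
noncomputable def nCondEnt (q : ℕ) [NeZero q] {Ω T : Type} [Fintype Ω] [Fintype T]
    (μ : Ω → ℝ) (X : Ω → ZMod q) (Y : Ω → T) : ℝ :=
  condEnt μ X Y / Real.logb 2 q

/- A matrix `M ∈ 𝔽_q^{k×k}` satisfies `(η, b)`-exponential polarization. -/
open Classical in
noncomputable def ExpPolar (q : ℕ) [NeZero q] (k : ℕ)
    (M : Matrix (Fin k) (Fin k) (ZMod q)) (η b : ℝ) : Prop :=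
  ∃ τ : ℝ, 0 < τ ∧ ∀ δ : ℝ, 0 ≤ δ → δ < τ →
    ∀ (Ω Alph : Type) [Fintype Ω] [Fintype Alph] (μ : Ω → ℝ),
      (∀ ω, 0 ≤ μ ω) → (∑ ω : Ω, μ ω = 1) →
      ∀ (U : Fin k → Ω → ZMod q) (A : Fin k → Ω → Alph),
      -- the pairs (U_i, A_i) are i.i.d. with common marginal p
      (∃ p : ZMod q × Alph → ℝ,
        (∀ (i : Fin k) (u : ZMod q) (a : Alph),
            pmfProb μ {ω | U i ω = u ∧ A i ω = a} = p (u, a)) ∧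
        (∀ (u : Fin k → ZMod q) (a : Fin k → Alph),
            pmfProb μ {ω | ∀ i, U i ω = u i ∧ A i ω = a i} = ∏ i, p (u i, a i))) →
      (∀ i : Fin k, nCondEnt q μ (U i) (A i) ≤ δ) →
      η * k ≤ ((Finset.univ : Finset (Fin k)).filter (fun j : Fin k =>
        nCondEnt q μ (fun ω => Matrix.vecMul (fun i => U i ω) M j)
          (fun ω => ((fun i : Fin (j : ℕ) =>
              Matrix.vecMul (fun i' => U i' ω) M (Fin.castLE j.isLt.le i)),
            (fun i => A i ω))) ≤ δ ^ b)).card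

/- A matrix is mixing if it is invertible and no row permutation of it is upper triangular. -/
def IsMixing {q k : ℕ} (M : Matrix (Fin k) (Fin k) (ZMod q)) : Prop :=
  IsUnit M.det ∧ ∀ σ : Equiv.Perm (Fin k), ¬ (∀ i j : Fin k, j < i → M (σ i) j = 0)

/- The Kronecker square `M ⊗ M`, with the standard (lexicographic) indexing by `Fin (k*k)`. -/
noncomputable def kron2 {q k : ℕ} (M : Matrix (Fin k) (Fin k) (ZMod q)) :
    Matrix (Fin (k * k)) (Fin (k * k)) (ZMod q) :=
  Matrix.reindex finProdFinEquiv finProdFinEquiv (Matrix.kroneckerMap (· * ·) M M)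


section SumsOverMassFunctions

open Classical in
theorem sum_pmfProb_mul {Ω S : Type} [Fintype Ω] [Fintype S] (μ : Ω → ℝ) (X : Ω → S)
    (F : S → ℝ) : ∑ s, pmfProb μ {ω | X ω = s} * F s = ∑ ω, μ ω * F (X ω) := by
  simp only [pmfProb, Finset.sum_mul, Set.mem_ofPred_eq]
  rw [Finset.sum_comm]
  refine Finset.sum_congr rfl fun ω _ => ?_
  rw [Finset.sum_eq_single (X ω)] <;> simp +contextual [eq_comm]

theorem sum_sum_pmfProb_mul {Ω S T : Type} [Fintype Ω] [Fintype S] [Fintype T] (μ : Ω → ℝ)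
    (X : Ω → S) (Y : Ω → T) (F : S → T → ℝ) :
    ∑ s, ∑ t, pmfProb μ {ω | X ω = s ∧ Y ω = t} * F s t = ∑ ω, μ ω * F (X ω) (Y ω) := by
  have h := sum_pmfProb_mul μ (fun ω => (X ω, Y ω)) (fun st => F st.1 st.2)
  simpa only [Fintype.sum_prod_type, Prod.mk.injEq] using h

theorem pmfProb_nonneg {Ω : Type} [Fintype Ω] {μ : Ω → ℝ} (hμ : ∀ ω, 0 ≤ μ ω) (S : Set Ω) :
    0 ≤ pmfProb μ S := by
  unfold pmfProb
  exact Finset.sum_nonneg fun ω _ => by split_ifs <;> simp [hμ]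

theorem pmfProb_mono {Ω : Type} [Fintype Ω] {μ : Ω → ℝ} (hμ : ∀ ω, 0 ≤ μ ω) {S T : Set Ω}
    (h : S ⊆ T) : pmfProb μ S ≤ pmfProb μ T := by
  unfold pmfProb
  refine Finset.sum_le_sum fun ω _ => ?_
  by_cases hS : ω ∈ S
  · simp [hS, h hS]
  · simp only [hS, if_false]
    split_ifs <;> simp [hμ]

theorem sum_pmfProb_and {Ω S T : Type} [Fintype Ω] [Fintype S] (μ : Ω → ℝ)
    (X : Ω → S) (Y : Ω → T) (t : T) :
    ∑ s, pmfProb μ {ω | X ω = s ∧ Y ω = t} = pmfProb μ {ω | Y ω = t} := by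
  classical
  unfold pmfProb
  rw [Finset.sum_comm]
  refine Finset.sum_congr rfl fun ω _ => ?_
  rw [Finset.sum_eq_single (X ω)] <;> simp +contextual [eq_comm]

end SumsOverMassFunctions

section Entropy

/-- Gibbs' inequality: coding with a subprobability kernel costs at least the entropy. -/
theorem condEnt_mul_log_two_le {Ω S T : Type} [Fintype Ω] [Fintype S] [Fintype T] {μ : Ω → ℝ}
    (hμ : ∀ ω, 0 ≤ μ ω) (hμ1 : ∑ ω, μ ω = 1) (X : Ω → S) (Y : Ω → T) (κ : S → T → ℝ)
    (hκ : ∀ s t, 0 < κ s t) (hκ1 : ∀ t, ∑ s, κ s t ≤ 1) :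
    condEnt μ X Y * Real.log 2 ≤ ∑ ω, μ ω * -Real.log (κ (X ω) (Y ω)) := by
  have hlog2 : Real.log 2 ≠ 0 := (Real.log_pos one_lt_two).ne'
  rw [← sum_sum_pmfProb_mul μ X Y (fun s t => -Real.log (κ s t))]
  have key : ∀ s t, (if pmfProb μ {ω | X ω = s ∧ Y ω = t} = 0 then 0
      else -(pmfProb μ {ω | X ω = s ∧ Y ω = t}) *
        Real.logb 2 (pmfProb μ {ω | X ω = s ∧ Y ω = t} / pmfProb μ {ω | Y ω = t})) * Real.log 2
      ≤ pmfProb μ {ω | X ω = s ∧ Y ω = t} * -Real.log (κ s t)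
        + (pmfProb μ {ω | Y ω = t} * κ s t - pmfProb μ {ω | X ω = s ∧ Y ω = t}) := by
    intro s t
    have hP0 := pmfProb_nonneg hμ {ω | X ω = s ∧ Y ω = t}
    have hPQ : pmfProb μ {ω | X ω = s ∧ Y ω = t} ≤ pmfProb μ {ω | Y ω = t} :=
      pmfProb_mono hμ fun ω h => h.2
    generalize pmfProb μ {ω | X ω = s ∧ Y ω = t} = P at *
    generalize pmfProb μ {ω | Y ω = t} = Q at *
    have hk := hκ s t
    split_ifs with h0
    · subst h0
      have := mul_nonneg hPQ hk.le
      simpa using this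
    · have hP : 0 < P := lt_of_le_of_ne hP0 (Ne.symm h0)
      have hQ : 0 < Q := hP.trans_le hPQ
      have h1 := Real.log_le_sub_one_of_pos (show 0 < Q * κ s t / P by positivity)
      rw [Real.log_div (by positivity) hP.ne', Real.log_mul hQ.ne' hk.ne'] at h1
      have h2 := mul_le_mul_of_nonneg_left h1 hP.le
      have h3 : P * (Q * κ s t / P - 1) = Q * κ s t - P := by field_simp
      rw [h3] at h2
      have h4 : -P * Real.logb 2 (P / Q) * Real.log 2 = -P * (Real.log P - Real.log Q) := by
        rw [Real.logb, Real.log_div hP.ne' hQ.ne']; field_simp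
      rw [h4]
      linarith
  have hsum := Finset.sum_le_sum fun s (_ : s ∈ Finset.univ) =>
    Finset.sum_le_sum fun t (_ : t ∈ Finset.univ) => key s t
  simp only [Finset.sum_add_distrib, Finset.sum_sub_distrib] at hsum
  have hA : ∑ s, ∑ t, pmfProb μ {ω | X ω = s ∧ Y ω = t} = 1 := by
    simpa [hμ1] using sum_sum_pmfProb_mul μ X Y (fun _ _ => 1)
  have hB : ∑ s, ∑ t, pmfProb μ {ω | Y ω = t} * κ s t ≤ 1 := by
    rw [Finset.sum_comm]
    calc ∑ t, ∑ s, pmfProb μ {ω | Y ω = t} * κ s t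
        = ∑ t, pmfProb μ {ω | Y ω = t} * ∑ s, κ s t := by simp only [Finset.mul_sum]
      _ ≤ ∑ t, pmfProb μ {ω | Y ω = t} * 1 := Finset.sum_le_sum fun t _ =>
          mul_le_mul_of_nonneg_left (hκ1 t) (pmfProb_nonneg hμ _)
      _ = 1 := by rw [sum_pmfProb_mul μ Y (fun _ => 1)]; simpa using hμ1
  unfold condEnt
  simp only [Finset.sum_mul]
  linarith

/-- A Fano-type inequality with a free parameter `θ`. -/
theorem condEnt_mul_log_two_le_of_decoder {Ω S T : Type} [Fintype Ω] [Fintype S] [Fintype T]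
    {μ : Ω → ℝ} (hμ : ∀ ω, 0 ≤ μ ω) (hμ1 : ∑ ω, μ ω = 1) (X : Ω → S) (Y : Ω → T)
    (g : T → S) {θ : ℝ} (hθ : 0 < θ) (hθ2 : θ ≤ 1 / 2) :
    condEnt μ X Y * Real.log 2 ≤
      2 * θ + pmfProb μ {ω | X ω ≠ g (Y ω)} * (Real.log (Fintype.card S) - Real.log θ) := by
  classical
  obtain ⟨ω₀, -⟩ : ∃ ω ∈ Finset.univ, μ ω ≠ 0 :=
    Finset.exists_ne_zero_of_sum_ne_zero (by rw [hμ1]; exact one_ne_zero)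
  have : Nonempty S := ⟨X ω₀⟩
  have hn : (0 : ℝ) < Fintype.card S := by exact_mod_cast Fintype.card_pos
  have hlogθ : -Real.log (1 - θ) ≤ 2 * θ := by
    have h := Real.one_sub_inv_le_log_of_pos (show 0 < 1 - θ by linarith)
    have h2 : (1 - θ)⁻¹ ≤ 1 + 2 * θ := by
      rw [inv_le_iff_one_le_mul₀ (by linarith)]
      nlinarith
    linarith
  refine (condEnt_mul_log_two_le hμ hμ1 X Y
    (fun s t => if s = g t then 1 - θ else θ / Fintype.card S) ?_ ?_).trans ?_
  · intro s t
    split_ifs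
    · linarith
    · positivity
  · intro t
    calc ∑ s, (if s = g t then 1 - θ else θ / Fintype.card S)
        ≤ ∑ s, ((if s = g t then 1 - θ else 0) + θ / Fintype.card S) := by
          refine Finset.sum_le_sum fun s _ => ?_
          have : 0 < θ / Fintype.card S := by positivity
          split_ifs <;> linarith
      _ = 1 := by
          rw [Finset.sum_add_distrib]
          simp only [Finset.sum_ite_eq', Finset.mem_univ, if_true, Finset.sum_const,
            Finset.card_univ, nsmul_eq_mul]
          field_simp
          ring
  · have h2θ : 2 * θ = ∑ ω, μ ω * (2 * θ) := by rw [← Finset.sum_mul, hμ1, one_mul]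
    rw [h2θ, pmfProb, Finset.sum_mul, ← Finset.sum_add_distrib]
    refine Finset.sum_le_sum fun ω _ => ?_
    by_cases h : X ω = g (Y ω)
    · simpa [h] using mul_le_mul_of_nonneg_left hlogθ (hμ ω)
    · simp only [h, if_false, Set.mem_ofPred_eq, ne_eq, not_false_eq_true, if_true]
      rw [Real.log_div hθ.ne' hn.ne']
      nlinarith [mul_nonneg (hμ ω) hθ.le]

/-- Maximum-likelihood guessing errs with probability at most the conditional entropy in nats. -/
theorem exists_pmfProb_ne_le_condEnt {Ω S T : Type} [Fintype Ω] [Fintype S] [Nonempty S]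
    [Fintype T] {μ : Ω → ℝ} (hμ : ∀ ω, 0 ≤ μ ω) (X : Ω → S) (Y : Ω → T) :
    ∃ g : T → S, pmfProb μ {ω | X ω ≠ g (Y ω)} ≤ condEnt μ X Y * Real.log 2 := by
  classical
  have hmax : ∀ t, ∃ s₀, ∀ s, pmfProb μ {ω | X ω = s ∧ Y ω = t} ≤
      pmfProb μ {ω | X ω = s₀ ∧ Y ω = t} := fun t =>
    Finite.exists_max fun s => pmfProb μ {ω | X ω = s ∧ Y ω = t}
  choose g hg using hmax
  refine ⟨g, ?_⟩
  have hlog2 : Real.log 2 ≠ 0 := (Real.log_pos one_lt_two).ne'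
  have hLHS : pmfProb μ {ω | X ω ≠ g (Y ω)} =
      ∑ t, (pmfProb μ {ω | Y ω = t} - pmfProb μ {ω | X ω = g t ∧ Y ω = t}) := by
    have h := sum_sum_pmfProb_mul μ X Y (fun s t => if s = g t then 0 else 1)
    have h2 : pmfProb μ {ω | X ω ≠ g (Y ω)} =
        ∑ ω, μ ω * (if X ω = g (Y ω) then 0 else 1) := by
      unfold pmfProb
      refine Finset.sum_congr rfl fun ω _ => ?_
      by_cases hx : X ω = g (Y ω) <;> simp [hx]
    rw [h2, ← h, Finset.sum_comm]
    refine Finset.sum_congr rfl fun t _ => ?_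
    rw [← sum_pmfProb_and μ X Y t, eq_sub_iff_add_eq,
      ← Finset.sum_erase_add _ _ (Finset.mem_univ (g t)),
      ← Finset.sum_erase_add (f := fun s => pmfProb μ {ω | X ω = s ∧ Y ω = t}) _
        (Finset.mem_univ (g t))]
    simp only [if_true, mul_zero, add_zero]
    congr 1
    refine Finset.sum_congr rfl fun s hs => ?_
    rw [if_neg (Finset.ne_of_mem_erase hs), mul_one]
  have hRHS : ∀ t, pmfProb μ {ω | Y ω = t} - pmfProb μ {ω | X ω = g t ∧ Y ω = t} =
      ∑ s, pmfProb μ {ω | X ω = s ∧ Y ω = t} *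
        (1 - pmfProb μ {ω | X ω = g t ∧ Y ω = t} / pmfProb μ {ω | Y ω = t}) := by
    intro t
    rw [← Finset.sum_mul, sum_pmfProb_and]
    have h0 := pmfProb_nonneg hμ {ω | X ω = g t ∧ Y ω = t}
    have h1 : pmfProb μ {ω | X ω = g t ∧ Y ω = t} ≤ pmfProb μ {ω | Y ω = t} :=
      pmfProb_mono hμ fun ω h => h.2
    by_cases hQ : pmfProb μ {ω | Y ω = t} = 0
    · rw [hQ] at h1 ⊢
      rw [le_antisymm h1 h0]
      simp
    · field_simp
  rw [hLHS, Finset.sum_congr rfl fun t _ => hRHS t, Finset.sum_comm]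
  unfold condEnt
  simp only [Finset.sum_mul]
  refine Finset.sum_le_sum fun s _ => Finset.sum_le_sum fun t _ => ?_
  have hP0 := pmfProb_nonneg hμ {ω | X ω = s ∧ Y ω = t}
  have hPQ : pmfProb μ {ω | X ω = s ∧ Y ω = t} ≤ pmfProb μ {ω | Y ω = t} :=
    pmfProb_mono hμ fun ω h => h.2
  have hPm := hg t s
  generalize pmfProb μ {ω | X ω = s ∧ Y ω = t} = P at *
  generalize pmfProb μ {ω | Y ω = t} = Q at *
  generalize pmfProb μ {ω | X ω = g t ∧ Y ω = t} = R at *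
  split_ifs with h0
  · simp [h0]
  · have hP : 0 < P := lt_of_le_of_ne hP0 (Ne.symm h0)
    have hQ : 0 < Q := hP.trans_le hPQ
    have h4 : -P * Real.logb 2 (P / Q) * Real.log 2 = P * -Real.log (P / Q) := by
      rw [Real.logb]; field_simp
    rw [h4]
    refine mul_le_mul_of_nonneg_left ?_ hP.le
    have h5 := Real.log_le_sub_one_of_pos (div_pos hP hQ)
    have h6 : P / Q ≤ R / Q := by gcongr
    linarith

end Entropy

/-- Union bound: more than `b` of `n` i.i.d. bad events, each of probability at most `r`,
occur simultaneously with probability at most `2 ^ n * r ^ b`. -/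
theorem pmfProb_lt_card_le {Ω α : Type} [Fintype Ω] [Fintype α] {n : ℕ} (μ : Ω → ℝ)
    (Z : Fin n → Ω → α) (p : α → ℝ) (hp : ∀ a, 0 ≤ p a) (hp1 : ∑ a, p a = 1)
    (hZ : ∀ z : Fin n → α, pmfProb μ {ω | (fun i => Z i ω) = z} = ∏ i, p (z i))
    (E : α → Prop) [DecidablePred E] {r b : ℝ} (hr0 : 0 ≤ r) (hr1 : r ≤ 1) (hb : 0 ≤ b)
    (hE : ∑ a, (if E a then p a else 0) ≤ r) :
    pmfProb μ {ω | b < ((Finset.univ.filter fun i => E (Z i ω)).card : ℝ)} ≤ 2 ^ n * r ^ b := by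
  classical
  set 𝒮 : Finset (Finset (Fin n)) := Finset.univ.filter fun S => b < (S.card : ℝ) with h𝒮
  have h1 : pmfProb μ {ω | b < ((Finset.univ.filter fun i => E (Z i ω)).card : ℝ)} =
      ∑ z : Fin n → α, (∏ i, p (z i)) *
        (if b < ((Finset.univ.filter fun i => E (z i)).card : ℝ) then 1 else 0) := by
    simp only [← hZ]
    rw [sum_pmfProb_mul μ (fun ω i => Z i ω) fun z =>
      if b < ((Finset.univ.filter fun i => E (z i)).card : ℝ) then 1 else 0]
    simp [pmfProb]
  have hterm0 : ∀ (S : Finset (Fin n)) (i : Fin n) (a : α),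
      0 ≤ if i ∈ S then (if E a then p a else 0) else p a := by
    intro S i a
    split_ifs <;> simp [hp]
  rw [h1]
  calc ∑ z : Fin n → α, (∏ i, p (z i)) *
        (if b < ((Finset.univ.filter fun i => E (z i)).card : ℝ) then 1 else 0)
      ≤ ∑ z : Fin n → α, ∑ S ∈ 𝒮, ∏ i,
          (if i ∈ S then (if E (z i) then p (z i) else 0) else p (z i)) := by
        refine Finset.sum_le_sum fun z _ => ?_
        by_cases hz : b < ((Finset.univ.filter fun i => E (z i)).card : ℝ)
        · rw [if_pos hz, mul_one]
          refine le_trans (le_of_eq ?_) (Finset.single_le_sum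
            (f := fun S : Finset (Fin n) => ∏ i,
              (if i ∈ S then (if E (z i) then p (z i) else 0) else p (z i)))
            (fun S _ => Finset.prod_nonneg fun i _ => hterm0 S i (z i))
            (show (Finset.univ.filter fun i => E (z i)) ∈ 𝒮 by simpa [h𝒮] using hz))
          refine Finset.prod_congr rfl fun i _ => ?_
          by_cases hi : E (z i) <;> simp [hi]
        · rw [if_neg hz, mul_zero]
          exact Finset.sum_nonneg fun S _ => Finset.prod_nonneg fun i _ => hterm0 S i (z i)
    _ = ∑ S ∈ 𝒮, ∏ i, ∑ a, (if i ∈ S then (if E a then p a else 0) else p a) := by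
        rw [Finset.sum_comm]
        refine Finset.sum_congr rfl fun S _ => ?_
        rw [Finset.prod_univ_sum, Fintype.piFinset_univ]
    _ ≤ ∑ S ∈ 𝒮, r ^ b := by
        refine Finset.sum_le_sum fun S hS => ?_
        have hS' : b ≤ (S.card : ℝ) := le_of_lt (by simpa [h𝒮] using hS)
        calc ∏ i, ∑ a, (if i ∈ S then (if E a then p a else 0) else p a)
            ≤ ∏ i, (if i ∈ S then r else 1) := by
              refine Finset.prod_le_prod
                (fun i _ => Finset.sum_nonneg fun a _ => hterm0 S i a) fun i _ => ?_
              by_cases hi : i ∈ S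
              · simpa only [if_pos hi] using hE
              · simp only [if_neg hi, hp1, le_refl]
          _ = r ^ (S.card : ℝ) := by
              rw [Finset.prod_ite_mem, Finset.univ_inter, Finset.prod_const, Real.rpow_natCast]
          _ ≤ r ^ b := Real.rpow_le_rpow_of_exponent_ge' hr0 hr1 hb hS'
    _ ≤ 2 ^ n * r ^ b := by
        rw [Finset.sum_const, nsmul_eq_mul]
        refine mul_le_mul_of_nonneg_right ?_ (Real.rpow_nonneg hr0 b)
        have := Finset.card_le_univ 𝒮
        rw [Fintype.card_finset, Fintype.card_fin] at this
        exact_mod_cast this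

/-- Bounded-distance decoding: if the left kernel of the first `m` columns of `M` has distance
greater than `2 * b`, then `x` is determined by the first `j ≥ m` entries of `x M` and any word
within distance `b` of `x`. -/
theorem exists_decoder {q k m : ℕ} (hmk : m ≤ k) {b : ℝ} (M : Matrix (Fin k) (Fin k) (ZMod q))
    (hdist : ∀ x : Fin k → ZMod q, x ≠ 0 →
      Matrix.vecMul x (M.submatrix id (Fin.castLE hmk)) = 0 →
      2 * b < ((Finset.univ : Finset (Fin k)).filter (fun i => x i ≠ 0)).card)
    {Alph : Type} (g : Alph → ZMod q) (j : Fin k) (hj : m ≤ j) :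
    ∃ D : (Fin (j : ℕ) → ZMod q) × (Fin k → Alph) → ZMod q,
      ∀ (u : Fin k → ZMod q) (a : Fin k → Alph),
        ((Finset.univ.filter fun i => u i ≠ g (a i)).card : ℝ) ≤ b →
        D (fun i => Matrix.vecMul u M (Fin.castLE j.isLt.le i), a) = Matrix.vecMul u M j := by
  have huniq : ∀ (u v : Fin k → ZMod q) (a : Fin k → Alph),
      ((Finset.univ.filter fun i => u i ≠ g (a i)).card : ℝ) ≤ b →
      ((Finset.univ.filter fun i => v i ≠ g (a i)).card : ℝ) ≤ b →
      (∀ i : Fin (j : ℕ), Matrix.vecMul u M (Fin.castLE j.isLt.le i) =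
        Matrix.vecMul v M (Fin.castLE j.isLt.le i)) → u = v := by
    intro u v a hu hv huv
    by_contra hne
    have hker : Matrix.vecMul (u - v) (M.submatrix id (Fin.castLE hmk)) = 0 := by
      funext i
      have h := huv (Fin.castLE hj i)
      have h2 : Matrix.vecMul (u - v) M (Fin.castLE hmk i) = 0 := by
        rw [Matrix.sub_vecMul, Pi.sub_apply, sub_eq_zero]
        exact h
      exact h2
    have h := hdist (u - v) (sub_ne_zero.mpr hne) hker
    have hsub : (Finset.univ.filter fun i => (u - v) i ≠ 0) ⊆
        (Finset.univ.filter fun i => u i ≠ g (a i)) ∪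
          (Finset.univ.filter fun i => v i ≠ g (a i)) := by
      intro i
      simp only [Finset.mem_filter, Finset.mem_univ, true_and, Finset.mem_union, Pi.sub_apply,
        sub_ne_zero]
      intro hi
      by_contra! hc
      exact hi (hc.1.trans hc.2.symm)
    have hcard := (Finset.card_le_card hsub).trans (Finset.card_union_le _ _)
    have hcard' : ((Finset.univ.filter fun i => (u - v) i ≠ 0).card : ℝ) ≤
        (Finset.univ.filter fun i => u i ≠ g (a i)).card +
          (Finset.univ.filter fun i => v i ≠ g (a i)).card := by exact_mod_cast hcard
    linarith
  have hex : ∀ ya : (Fin (j : ℕ) → ZMod q) × (Fin k → Alph), ∃ d : ZMod q,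
      ∀ u : Fin k → ZMod q, ((Finset.univ.filter fun i => u i ≠ g (ya.2 i)).card : ℝ) ≤ b →
        (fun i => Matrix.vecMul u M (Fin.castLE j.isLt.le i)) = ya.1 →
        d = Matrix.vecMul u M j := by
    intro ya
    by_cases h : ∃ u : Fin k → ZMod q,
        ((Finset.univ.filter fun i => u i ≠ g (ya.2 i)).card : ℝ) ≤ b ∧
        (fun i => Matrix.vecMul u M (Fin.castLE j.isLt.le i)) = ya.1
    · obtain ⟨v, hv, hvy⟩ := h
      refine ⟨Matrix.vecMul v M j, fun u hu huy => ?_⟩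
      rw [huniq v u ya.2 hv hu fun i => congrFun (hvy.trans huy.symm) i]
    · exact ⟨0, fun u hu huy => (h ⟨u, hu, huy⟩).elim⟩
  choose D hD using hex
  exact ⟨D, fun u a hu => hD _ u hu rfl⟩

/-- The entropy of an output past the `m`-th one, given the earlier outputs and the side
information, in nats and with a free parameter `θ`. -/
theorem nCondEnt_vecMul_mul_log_le (q : ℕ) [NeZero q] (hq : 1 < q) {k m : ℕ} (hmk : m ≤ k)
    {b : ℝ} (hb : 0 ≤ b) (M : Matrix (Fin k) (Fin k) (ZMod q))
    (hdist : ∀ x : Fin k → ZMod q, x ≠ 0 →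
      Matrix.vecMul x (M.submatrix id (Fin.castLE hmk)) = 0 →
      2 * b < ((Finset.univ : Finset (Fin k)).filter (fun i => x i ≠ 0)).card)
    {δ : ℝ} (hδ : 0 ≤ δ) (hδ1 : δ * Real.log q ≤ 1)
    {Ω Alph : Type} [Fintype Ω] [Fintype Alph] {μ : Ω → ℝ}
    (hμ : ∀ ω, 0 ≤ μ ω) (hμ1 : ∑ ω, μ ω = 1)
    (U : Fin k → Ω → ZMod q) (A : Fin k → Ω → Alph) (p : ZMod q × Alph → ℝ)
    (hp : ∀ (i : Fin k) (u : ZMod q) (a : Alph),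
      pmfProb μ {ω | U i ω = u ∧ A i ω = a} = p (u, a))
    (hprod : ∀ (u : Fin k → ZMod q) (a : Fin k → Alph),
      pmfProb μ {ω | ∀ i, U i ω = u i ∧ A i ω = a i} = ∏ i, p (u i, a i))
    (hent : ∀ i : Fin k, nCondEnt q μ (U i) (A i) ≤ δ)
    (j : Fin k) (hj : m ≤ j) {θ : ℝ} (hθ : 0 < θ) (hθ2 : θ ≤ 1 / 2) :
    nCondEnt q μ (fun ω => Matrix.vecMul (fun i => U i ω) M j)
      (fun ω => ((fun i : Fin (j : ℕ) =>
          Matrix.vecMul (fun i' => U i' ω) M (Fin.castLE j.isLt.le i)),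
        (fun i => A i ω))) * Real.log q ≤
      2 * θ + 2 ^ k * (δ * Real.log q) ^ b * (Real.log q - Real.log θ) := by
  classical
  have hlogq : 0 < Real.log q := Real.log_pos (by exact_mod_cast hq)
  have hlog2 : 0 < Real.log 2 := Real.log_pos one_lt_two
  have hnat : ∀ x : ℝ, x / Real.logb 2 q * Real.log q = x * Real.log 2 := by
    intro x
    rw [Real.logb]
    field_simp
  obtain ⟨g, hg⟩ := exists_pmfProb_ne_le_condEnt hμ (U j) (A j)
  have hE : ∑ z : ZMod q × Alph, (if z.1 ≠ g z.2 then p z else 0) ≤ δ * Real.log q := by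
    have h1 : ∑ z : ZMod q × Alph, (if z.1 ≠ g z.2 then p z else 0) =
        pmfProb μ {ω | U j ω ≠ g (A j ω)} := by
      have h := sum_sum_pmfProb_mul μ (U j) (A j) (fun s t => if s ≠ g t then 1 else 0)
      simp only [hp] at h
      rw [Fintype.sum_prod_type]
      simp only [mul_ite, mul_one, mul_zero] at h
      rw [h]
      unfold pmfProb
      exact Finset.sum_congr rfl fun ω _ => by congr
    rw [h1]
    refine hg.trans ?_
    rw [← hnat]
    exact mul_le_mul_of_nonneg_right (hent j) hlogq.le
  have hZ : ∀ z : Fin k → ZMod q × Alph,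
      pmfProb μ {ω | (fun i => (U i ω, A i ω)) = z} = ∏ i, p (z i) := by
    intro z
    rw [← hprod (fun i => (z i).1) (fun i => (z i).2)]
    congr 1
    ext ω
    simp [funext_iff, Prod.ext_iff]
  have hp0 : ∀ z, 0 ≤ p z := fun z => by
    rw [← hp j z.1 z.2]
    exact pmfProb_nonneg hμ _
  have hp1 : ∑ z, p z = 1 := by
    have h := sum_sum_pmfProb_mul μ (U j) (A j) (fun _ _ => 1)
    simp only [hp, mul_one] at h
    rw [Fintype.sum_prod_type, h, hμ1]
  have hbad := pmfProb_lt_card_le μ (fun i ω => (U i ω, A i ω)) p hp0 hp1 hZ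
    (fun z => z.1 ≠ g z.2) (mul_nonneg hδ hlogq.le) hδ1 hb hE
  obtain ⟨D, hD⟩ := exists_decoder hmk M hdist g j hj
  have hfano := condEnt_mul_log_two_le_of_decoder hμ hμ1
    (fun ω => Matrix.vecMul (fun i => U i ω) M j)
    (fun ω => ((fun i : Fin (j : ℕ) =>
      Matrix.vecMul (fun i' => U i' ω) M (Fin.castLE j.isLt.le i)), (fun i => A i ω))) D hθ hθ2
  rw [ZMod.card] at hfano
  unfold nCondEnt
  rw [hnat]
  refine hfano.trans ?_
  have hlogθ : Real.log θ ≤ 0 := Real.log_nonpos hθ.le (by linarith)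
  gcongr
  · linarith
  · refine (pmfProb_mono hμ fun ω hω => ?_).trans hbad
    by_contra hle
    exact hω (hD (fun i => U i ω) (fun i => A i ω) (not_lt.mp hle)).symm

/-- if `M = [M₀ | M₁]` is mixing, `M₀` consists of the first `m = (1-η)k`
columns, and `ker M₀ᵀ` is a code of distance greater than `2b`, then `M` satisfies
`(η, b-ε)`-exponential polarization for every `ε > 0`. -/
theorem stmt10 (q : ℕ) [NeZero q] (hq : Nat.Prime q) {k m : ℕ} (hmk : m ≤ k)
    (η : ℝ) (hη : 0 < η) (hη1 : η < 1) (hm : (m : ℝ) = (1 - η) * k)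
    (b : ℝ) (hb : 1 < b)
    (M : Matrix (Fin k) (Fin k) (ZMod q)) (hM : IsMixing M)
    (hdist : ∀ x : Fin k → ZMod q, x ≠ 0 →
      Matrix.vecMul x (M.submatrix id (Fin.castLE hmk)) = 0 →
      2 * b < ((Finset.univ : Finset (Fin k)).filter (fun i => x i ≠ 0)).card) :
    ∀ ε : ℝ, 0 < ε → ExpPolar q k M η (b - ε) := by
  intro ε hε
  have hq1 : 1 < q := hq.one_lt
  have hlogq : 0 < Real.log q := Real.log_pos (by exact_mod_cast hq1)
  have hb0 : 0 < b := by linarith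
  set C : ℝ := 2 ^ k * Real.log q ^ b with hC
  have hlim : Filter.Tendsto (fun δ : ℝ =>
      (2 + C * Real.log q) * δ ^ ε - C * b * (Real.log δ * δ ^ ε)) (nhdsWithin 0 (Set.Ioi 0))
      (nhds 0) := by
    have h1 : Filter.Tendsto (fun δ : ℝ => δ ^ ε) (nhdsWithin 0 (Set.Ioi 0)) (nhds 0) := by
      have h := (Real.continuousAt_rpow_const 0 ε (Or.inr hε.le)).tendsto
      rw [Real.zero_rpow hε.ne'] at h
      exact h.mono_left nhdsWithin_le_nhds
    have h2 := tendsto_log_mul_rpow_nhdsGT_zero hε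
    simpa using (h1.const_mul (2 + C * Real.log q)).sub (h2.const_mul (C * b))
  obtain ⟨τ, hτ, hsmall⟩ := mem_nhdsGT_iff_exists_Ioo_subset.mp (hlim.eventually_lt_const hlogq)
  have hbp : (0 : ℝ) < (1 / 2) ^ (1 / b) := Real.rpow_pos_of_pos (by norm_num) _
  refine ⟨min τ (min ((1 / 2) ^ (1 / b)) (1 / Real.log q)),
    lt_min hτ (lt_min hbp (by positivity)), ?_⟩
  rintro δ hδ hδτ Ω Alph _ _ μ hμ hμ1 U A ⟨p, hp, hprod⟩ hent
  obtain ⟨hδ1, hδ2, hδ3⟩ : δ < τ ∧ δ < (1 / 2) ^ (1 / b) ∧ δ < 1 / Real.log q := by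
    simpa only [lt_min_iff] using hδτ
  have hδlog : δ * Real.log q ≤ 1 := ((lt_div_iff₀ hlogq).mp hδ3).le
  have hcount : η * k ≤ ((Finset.univ.filter fun j : Fin k => m ≤ (j : ℕ)).card : ℝ) := by
    have h1 : (Finset.univ.filter fun j : Fin k => m ≤ (j : ℕ)).card = k - m := by
      have h2 := Finset.card_filter_add_card_filter_not (s := (Finset.univ : Finset (Fin k)))
        (fun j : Fin k => (j : ℕ) < m)
      simp only [not_lt, Fin.card_filter_val_lt, Finset.card_univ, Fintype.card_fin] at h2
      omega
    rw [h1, Nat.cast_sub hmk, hm]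
    linarith
  refine hcount.trans (Nat.cast_le.mpr (Finset.card_le_card fun j hj => ?_))
  simp only [Finset.mem_filter, Finset.mem_univ, true_and] at hj ⊢
  have hmain := fun θ hθ hθ2 => nCondEnt_vecMul_mul_log_le q hq1 hmk hb0.le M hdist hδ hδlog
    hμ hμ1 U A p hp hprod hent j hj (θ := θ) hθ hθ2
  refine le_of_mul_le_mul_right ?_ hlogq
  rcases hδ.eq_or_lt with rfl | hδpos
  · refine le_trans ?_ (mul_nonneg (Real.rpow_nonneg le_rfl _) hlogq.le)
    refine le_of_forall_pos_le_add fun θ hθ => ?_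
    have h := hmain (min (θ / 2) (1 / 2)) (lt_min (by linarith) (by norm_num)) (min_le_right _ _)
    rw [zero_mul, Real.zero_rpow hb0.ne', mul_zero, zero_mul] at h
    have := min_le_left (θ / 2) (1 / 2 : ℝ)
    linarith
  · have hθ2 : δ ^ b ≤ 1 / 2 := by
      have h := Real.rpow_le_rpow hδ hδ2.le hb0.le
      rwa [← Real.rpow_mul (by norm_num), one_div_mul_cancel hb0.ne', Real.rpow_one] at h
    refine (hmain (δ ^ b) (Real.rpow_pos_of_pos hδpos b) hθ2).trans ?_
    have hs : (2 + C * Real.log q) * δ ^ ε - C * b * (Real.log δ * δ ^ ε) < Real.log q :=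
      hsmall ⟨hδpos, hδ1⟩
    have hsplit : δ ^ b = δ ^ (b - ε) * δ ^ ε := by
      rw [← Real.rpow_add hδpos, sub_add_cancel]
    calc 2 * δ ^ b + 2 ^ k * (δ * Real.log q) ^ b * (Real.log q - Real.log (δ ^ b))
        = δ ^ (b - ε) *
          ((2 + C * Real.log q) * δ ^ ε - C * b * (Real.log δ * δ ^ ε)) := by
          rw [Real.mul_rpow hδ hlogq.le, Real.log_rpow hδpos, hsplit, hC]
          ring
      _ ≤ δ ^ (b - ε) * Real.log q :=
          mul_le_mul_of_nonneg_left hs.le (Real.rpow_nonneg hδ _)
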